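/- Suppose m2 > m1, m1 + m2 > 0, h0 ≠ 0, and μ > m1·ρ1², where ρ1 = |h0|/(m2 − m1), and set ρ2 = ρ3 = √((μ − m1·ρ1²)/(m1 + m2)). Then the mixed point (ρ1, ρ2, ρ2) is an equilibrium of the amplitude system, and the Jacobian W of the amplitude system at this point has the eigenvector (0, 1, −1) with eigenvalue 2·(m2 − m1)·(ρ2² − ρ1²). -/

import Mathlib

/-- First component of the amplitude system vector field. -/
noncomputable def G1 (mu h0 m1 m2 a b c : ℝ) : ℝ :=
  mu * a + |h0| * b * c - m1 * a ^ 3 - m2 * (b ^ 2 + c ^ 2) * a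

/-- Second component of the amplitude system vector field. -/
noncomputable def G2 (mu h0 m1 m2 a b c : ℝ) : ℝ :=
  mu * b + |h0| * a * c - m1 * b ^ 3 - m2 * (a ^ 2 + c ^ 2) * b

/-- Third component of the amplitude system vector field. -/
noncomputable def G3 (mu h0 m1 m2 a b c : ℝ) : ℝ :=
  mu * c + |h0| * a * b - m1 * c ^ 3 - m2 * (a ^ 2 + b ^ 2) * c

/-- The Jacobian matrix W of the amplitude system at (a,b,c), given by the matrix
of partial derivatives of (G1, G2, G3). -/
noncomputable def W (mu h0 m1 m2 a b c : ℝ) : Matrix (Fin 3) (Fin 3) ℝ :=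
  !![deriv (fun x => G1 mu h0 m1 m2 x b c) a, deriv (fun y => G1 mu h0 m1 m2 a y c) b,
       deriv (fun z => G1 mu h0 m1 m2 a b z) c;
     deriv (fun x => G2 mu h0 m1 m2 x b c) a, deriv (fun y => G2 mu h0 m1 m2 a y c) b,
       deriv (fun z => G2 mu h0 m1 m2 a b z) c;
     deriv (fun x => G3 mu h0 m1 m2 x b c) a, deriv (fun y => G3 mu h0 m1 m2 a y c) b,
       deriv (fun z => G3 mu h0 m1 m2 a b z) c]

/-- Derivative of a general real cubic. -/
theorem deriv_cubic_aux (f : ℝ → ℝ) (A B C D x : ℝ)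
    (hf : ∀ t, f t = A + B * t + C * t ^ 2 + D * t ^ 3) :
    deriv f x = B + 2 * C * x + 3 * D * x ^ 2 := by
  have e : f = fun t => A + B * t + C * t ^ 2 + D * t ^ 3 := funext hf
  rw [e]
  have h := ((((hasDerivAt_id x).const_mul B).const_add A).add
    (((hasDerivAt_id x).pow 2).const_mul C)).add (((hasDerivAt_id x).pow 3).const_mul D)
  have h2 : HasDerivAt (fun t : ℝ => A + B * t + C * t ^ 2 + D * t ^ 3)
      (B + 2 * C * x + 3 * D * x ^ 2) x := by
    refine HasDerivAt.congr_deriv (f' := _) h ?_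
    simp only [id, Nat.cast_ofNat]
    ring
  exact h2.deriv

/-- For m2 > m1, m1 + m2 > 0, h0 ≠ 0 and μ > m1·ρ1² with ρ1 = |h0|/(m2−m1) and
ρ2 = √((μ − m1·ρ1²)/(m1+m2)), the mixed point (ρ1, ρ2, ρ2) is an equilibrium of
the amplitude system, and the Jacobian there has eigenvector (0, 1, −1) with
eigenvalue 2·(m2 − m1)·(ρ2² − ρ1²). -/
theorem mixed_equilibrium_eigenvalue (mu h0 m1 m2 rho1 rho2 : ℝ)
    (hm : m1 < m2) (hs : 0 < m1 + m2) (hh : h0 ≠ 0)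
    (hrho1 : rho1 = |h0| / (m2 - m1))
    (hmu : m1 * rho1 ^ 2 < mu)
    (hrho2 : rho2 = Real.sqrt ((mu - m1 * rho1 ^ 2) / (m1 + m2))) :
    (G1 mu h0 m1 m2 rho1 rho2 rho2 = 0 ∧ G2 mu h0 m1 m2 rho1 rho2 rho2 = 0 ∧
      G3 mu h0 m1 m2 rho1 rho2 rho2 = 0) ∧
    (W mu h0 m1 m2 rho1 rho2 rho2).mulVec ![0, 1, -1]
      = (2 * (m2 - m1) * (rho2 ^ 2 - rho1 ^ 2)) • ![(0 : ℝ), 1, -1] := by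
  have hH : |h0| = rho1 * (m2 - m1) := by
    rw [hrho1, div_mul_cancel₀ _ (sub_pos.mpr hm).ne']
  have hsq : rho2 ^ 2 = (mu - m1 * rho1 ^ 2) / (m1 + m2) := by
    rw [hrho2, Real.sq_sqrt (div_nonneg (by linarith) hs.le)]
  have hM : mu = m1 * rho1 ^ 2 + (m1 + m2) * rho2 ^ 2 := by
    rw [hsq, mul_div_cancel₀ _ hs.ne']
    ring
  clear hrho1 hrho2 hsq hmu
  have d12 := deriv_cubic_aux (fun y => G1 mu h0 m1 m2 rho1 y rho2)
    (mu * rho1 - m1 * rho1 ^ 3 - m2 * rho2 ^ 2 * rho1) (|h0| * rho2) (-m2 * rho1) 0 rho2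
    (fun t => by simp only [G1]; ring)
  have d13 := deriv_cubic_aux (fun y => G1 mu h0 m1 m2 rho1 rho2 y)
    (mu * rho1 - m1 * rho1 ^ 3 - m2 * rho2 ^ 2 * rho1) (|h0| * rho2) (-m2 * rho1) 0 rho2
    (fun t => by simp only [G1]; ring)
  have d22 := deriv_cubic_aux (fun y => G2 mu h0 m1 m2 rho1 y rho2)
    (|h0| * rho1 * rho2) (mu - m2 * (rho1 ^ 2 + rho2 ^ 2)) 0 (-m1) rho2
    (fun t => by simp only [G2]; ring)
  have d23 := deriv_cubic_aux (fun y => G2 mu h0 m1 m2 rho1 rho2 y)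
    (mu * rho2 - m1 * rho2 ^ 3 - m2 * rho1 ^ 2 * rho2) (|h0| * rho1) (-m2 * rho2) 0 rho2
    (fun t => by simp only [G2]; ring)
  have d32 := deriv_cubic_aux (fun y => G3 mu h0 m1 m2 rho1 y rho2)
    (mu * rho2 - m1 * rho2 ^ 3 - m2 * rho1 ^ 2 * rho2) (|h0| * rho1) (-m2 * rho2) 0 rho2
    (fun t => by simp only [G3]; ring)
  have d33 := deriv_cubic_aux (fun y => G3 mu h0 m1 m2 rho1 rho2 y)
    (|h0| * rho1 * rho2) (mu - m2 * (rho1 ^ 2 + rho2 ^ 2)) 0 (-m1) rho2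
    (fun t => by simp only [G3]; ring)
  refine ⟨⟨?_, ?_, ?_⟩, ?_⟩
  · rw [G1, hH, hM]; ring
  · rw [G2, hH, hM]; ring
  · rw [G3, hH, hM]; ring
  · unfold W
    rw [d12, d13, d22, d23, d32, d33, hH, hM]
    ext i
    fin_cases i
    · simp [Matrix.mulVec, dotProduct, Fin.sum_univ_three]
    · simp [Matrix.mulVec, dotProduct, Fin.sum_univ_three]
      ring
    · simp [Matrix.mulVec, dotProduct, Fin.sum_univ_three]
      ring
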